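/- arXiv:2510.26938 — 7 statements merged into one kernel-verified Lean document; each statement's English description precedes it below -/
import Mathlib

section
/- Let G be a finite simple graph without isolated vertices, with m edges, and let k be a positive integer. Then G has a vertex cover of size at most k if and only if G admits a star decomposition P with wgt(P) ≤ m + k. -/
open SimpleGraph

/-- Inclusive vertex split of the vertex `u` of `G`.  The resulting graph `G'` lives on
vertex set `Option V`, where `some u` plays the role of the first copy `v₁` of `u` and
`none` plays the role of the second copy `v₂`; every other vertex `x` is represented by
`some x`, with all adjacencies among such vertices unchanged.  The neighborhoods of the
two copies are contained in `N(u)` and their union is `N(u)`; the two copies are not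
adjacent to each other. -/
def IsInclusiveSplit {V : Type} (G : SimpleGraph V) (G' : SimpleGraph (Option V))
    (u : V) : Prop :=
  (∀ x y : V, x ≠ u → y ≠ u → (G'.Adj (some x) (some y) ↔ G.Adj x y)) ∧
  (¬ G'.Adj (some u) none) ∧
  (∀ x : V, G'.Adj (some u) (some x) → G.Adj u x) ∧
  (∀ x : V, G'.Adj none (some x) → G.Adj u x) ∧
  (∀ x : V, G.Adj u x → (G'.Adj (some u) (some x) ∨ G'.Adj none (some x)))

/-- Exclusive vertex split: an inclusive split in which the neighborhoods of the two
copies are disjoint (they partition `N(u)`). -/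
def IsExclusiveSplit {V : Type} (G : SimpleGraph V) (G' : SimpleGraph (Option V))
    (u : V) : Prop :=
  IsInclusiveSplit G G' u ∧
  ∀ x : V, ¬ (G'.Adj (some u) (some x) ∧ G'.Adj none (some x))

/-- `InclReach P k V G` : the graph `G` can be transformed, by a sequence of **at most**
`k` inclusive vertex splits, into a graph satisfying the property `P`. -/
def InclReach (P : (W : Type) → SimpleGraph W → Prop) :
    (k : ℕ) → (V : Type) → SimpleGraph V → Prop
  | 0, V, G => P V G
  | k+1, V, G => P V G ∨ ∃ (u : V) (G' : SimpleGraph (Option V)),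
      IsInclusiveSplit G G' u ∧ InclReach P k (Option V) G'

/-- `ExclReach P k V G` : the graph `G` can be transformed, by a sequence of **at most**
`k` exclusive vertex splits, into a graph satisfying the property `P`. -/
def ExclReach (P : (W : Type) → SimpleGraph W → Prop) :
    (k : ℕ) → (V : Type) → SimpleGraph V → Prop
  | 0, V, G => P V G
  | k+1, V, G => P V G ∨ ∃ (u : V) (G' : SimpleGraph (Option V)),
      IsExclusiveSplit G G' u ∧ ExclReach P k (Option V) G'

/-- The vertex type obtained from `V` after `k` vertex splits. -/
def IterOpt : ℕ → Type → Type
  | 0, V => V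
  | k+1, V => IterOpt k (Option V)

/-- `InclSeq k V G G'` : `G'` is obtained from `G` by a sequence of **exactly** `k`
inclusive vertex splits. -/
def InclSeq : (k : ℕ) → (V : Type) → SimpleGraph V → SimpleGraph (IterOpt k V) → Prop
  | 0, _V, G, G' => G' = G
  | k+1, V, G, G' => ∃ (u : V) (G₁ : SimpleGraph (Option V)),
      IsInclusiveSplit G G₁ u ∧ InclSeq k (Option V) G₁ G'

/-- `ExclSeq k V G G'` : `G'` is obtained from `G` by a sequence of **exactly** `k`
exclusive vertex splits. -/
def ExclSeq : (k : ℕ) → (V : Type) → SimpleGraph V → SimpleGraph (IterOpt k V) → Prop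
  | 0, _V, G, G' => G' = G
  | k+1, V, G, G' => ∃ (u : V) (G₁ : SimpleGraph (Option V)),
      IsExclusiveSplit G G₁ u ∧ ExclSeq k (Option V) G₁ G'

/-- A (single) cycle: a connected graph in which every vertex has degree exactly 2. -/
def IsSingleCycle {W : Type} (G : SimpleGraph W) : Prop :=
  G.Connected ∧ ∀ v : W, (G.neighborSet v).ncard = 2

/-- A cycle graph: a disjoint union of cycles, i.e. every connected component is a cycle. -/
def IsCycleGraph {W : Type} (G : SimpleGraph W) : Prop :=
  ∀ C : G.ConnectedComponent, IsSingleCycle (G.induce C.supp)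

/-- A star: a single central vertex adjacent to all other vertices, with no other edges. -/
def IsStarGraph {W : Type} (G : SimpleGraph W) : Prop :=
  ∃ c : W, ∀ v w : W, G.Adj v w ↔ ((v = c ∧ w ≠ c) ∨ (w = c ∧ v ≠ c))

/-- A constellation: a disjoint union of stars, i.e. every connected component is a star. -/
def IsConstellation {W : Type} (G : SimpleGraph W) : Prop :=
  ∀ C : G.ConnectedComponent, IsStarGraph (G.induce C.supp)

/-- A linear forest: every connected component is a path with at least one edge.
Equivalently (for finite graphs): acyclic, maximum degree at most 2,
and no isolated vertices. -/
def IsLinearForest {W : Type} (G : SimpleGraph W) : Prop :=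
  G.IsAcyclic ∧ (∀ v : W, (G.neighborSet v).ncard ≤ 2) ∧ (∀ v : W, ∃ w, G.Adj v w)

/-- The weight of a set of subgraphs: the sum of the numbers of vertices of its members. -/
noncomputable def wgt {V : Type} {G : SimpleGraph V} (P : Finset G.Subgraph) : ℕ :=
  ∑ H ∈ P, H.verts.ncard

/-- The edge sets of the members of `P` form a partition of the edge set of `G`:
every edge of `G` lies in exactly one member of `P`. -/
def IsEdgeDecomposition {V : Type} {G : SimpleGraph V} (P : Finset G.Subgraph) : Prop :=
  ∀ e ∈ G.edgeSet, ∃! H : G.Subgraph, H ∈ P ∧ e ∈ H.edgeSet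

/-- A star decomposition of `G`: a set of subgraphs of `G`, each of which is a star
(with a nonempty edge set, as parts of a partition are nonempty), whose edge sets
partition `E(G)`. -/
def IsStarDecomposition {V : Type} {G : SimpleGraph V} (P : Finset G.Subgraph) : Prop :=
  (∀ H ∈ P, H.edgeSet.Nonempty ∧ IsStarGraph H.coe) ∧ IsEdgeDecomposition P

/-- A `Γ`-decomposition of `G`, where `Γ` is a family of graphs: a set of subgraphs of
`G`, each isomorphic to a member of `Γ` (with a nonempty edge set, as parts of a
partition are nonempty), whose edge sets partition `E(G)`. -/
def IsGammaDecomposition {V ι : Type} (Γ : ι → (W : Type) × SimpleGraph W)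
    {G : SimpleGraph V} (P : Finset G.Subgraph) : Prop :=
  (∀ H ∈ P, H.edgeSet.Nonempty ∧ ∃ i : ι, Nonempty (H.coe ≃g (Γ i).2)) ∧
  IsEdgeDecomposition P

/-- `G` is a disjoint union of graphs of the family `Γ`: every connected component of
`G` is isomorphic to a member of `Γ`. -/
def IsDisjointUnionOf {V ι : Type} (Γ : ι → (W : Type) × SimpleGraph W)
    (G : SimpleGraph V) : Prop :=
  ∀ C : G.ConnectedComponent, ∃ i : ι, Nonempty ((G.induce C.supp) ≃g (Γ i).2)
/-- The star with center `v` and leaf set `A`, as a subgraph of `G`. -/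
def starSubgraph {V : Type} (G : SimpleGraph V) (v : V) (A : Set V)
    (hA : A ⊆ G.neighborSet v) : G.Subgraph where
  verts := insert v A
  Adj x y := (x = v ∧ y ∈ A) ∨ (y = v ∧ x ∈ A)
  adj_sub := by
    rintro x y (⟨rfl, h⟩ | ⟨rfl, h⟩)
    · exact hA h
    · exact (hA h).symm
  edge_vert := by
    rintro x y (⟨rfl, -⟩ | ⟨-, h⟩)
    · exact Set.mem_insert _ _
    · exact Set.mem_insert_of_mem _ h
  symm := ⟨fun _ _ h => h.symm⟩

theorem mem_edgeSet_starSubgraph {V : Type} {G : SimpleGraph V} {v : V} {A : Set V}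
    (hA : A ⊆ G.neighborSet v) (e : Sym2 V) :
    e ∈ (starSubgraph G v A hA).edgeSet ↔ ∃ w ∈ A, e = s(v, w) := by
  induction e with
  | h x y =>
    change (x = v ∧ y ∈ A) ∨ (y = v ∧ x ∈ A) ↔ _
    constructor
    · rintro (⟨rfl, h⟩ | ⟨rfl, h⟩)
      · exact ⟨y, h, rfl⟩
      · exact ⟨x, h, Sym2.eq_swap⟩
    · rintro ⟨w, hw, h⟩
      rcases Sym2.eq_iff.1 h with ⟨rfl, rfl⟩ | ⟨rfl, rfl⟩
      · exact Or.inl ⟨rfl, hw⟩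
      · exact Or.inr ⟨rfl, hw⟩

theorem isStarGraph_coe_starSubgraph {V : Type} {G : SimpleGraph V} {v : V} {A : Set V}
    (hA : A ⊆ G.neighborSet v) : IsStarGraph (starSubgraph G v A hA).coe := by
  have hv : v ∉ A := fun h => G.loopless.irrefl v (hA h)
  refine ⟨⟨v, Set.mem_insert _ _⟩, ?_⟩
  rintro ⟨x, hx⟩ ⟨y, hy⟩
  change (x = v ∧ y ∈ A) ∨ (y = v ∧ x ∈ A) ↔ _
  simp only [ne_eq]
  have hx' : x = v ∨ x ∈ A := hx
  have hy' : y = v ∨ y ∈ A := hy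
  grind

theorem exists_center_of_isStarGraph_coe {V : Type} {G : SimpleGraph V} {H : G.Subgraph}
    (h : IsStarGraph H.coe) :
    ∃ c ∈ H.verts, H.edgeSet = (fun w => s(c, w)) '' (H.verts \ {c}) := by
  obtain ⟨⟨c, hc⟩, h⟩ := h
  refine ⟨c, hc, ?_⟩
  have key (x y : V) (hx : x ∈ H.verts) (hy : y ∈ H.verts) :
      H.Adj x y ↔ ((x = c ∧ y ≠ c) ∨ (y = c ∧ x ≠ c)) := by
    simpa using h ⟨x, hx⟩ ⟨y, hy⟩
  ext e
  induction e with
  | h x y =>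
    rw [Subgraph.mem_edgeSet]
    constructor
    · intro hxy
      have hx := H.edge_vert hxy
      have hy := H.edge_vert hxy.symm
      rcases (key x y hx hy).1 hxy with ⟨rfl, h'⟩ | ⟨rfl, h'⟩
      · exact ⟨y, ⟨hy, h'⟩, rfl⟩
      · exact ⟨x, ⟨hx, h'⟩, Sym2.eq_swap⟩
    · rintro ⟨w, ⟨hw, hwc⟩, h'⟩
      have hcw : H.Adj c w := (key c w hc hw).2 (Or.inl ⟨rfl, hwc⟩)
      rcases Sym2.eq_iff.1 h' with ⟨rfl, rfl⟩ | ⟨rfl, rfl⟩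
      · exact hcw
      · exact hcw.symm

theorem ncard_verts_of_isStarGraph_coe {V : Type} [Finite V] {G : SimpleGraph V}
    {H : G.Subgraph} (h : IsStarGraph H.coe) : H.verts.ncard = H.edgeSet.ncard + 1 := by
  obtain ⟨c, hc, he⟩ := exists_center_of_isStarGraph_coe h
  rw [he, Set.ncard_image_of_injective _ fun _ _ => Sym2.congr_right.1,
    Set.ncard_sdiff_singleton_add_one hc]

theorem IsEdgeDecomposition.sum_ncard_edgeSet {V : Type} [Finite V] {G : SimpleGraph V}
    {P : Finset G.Subgraph} (h : IsEdgeDecomposition P) :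
    ∑ H ∈ P, H.edgeSet.ncard = G.edgeSet.ncard := by
  classical
  have hU : G.edgeSet.toFinite.toFinset = P.biUnion fun H => H.edgeSet.toFinite.toFinset := by
    ext e
    simp only [Set.Finite.mem_toFinset, Finset.mem_biUnion]
    exact ⟨fun he => (h e he).exists, fun ⟨H, _, he⟩ => H.edgeSet_subset he⟩
  rw [Set.ncard_eq_toFinset_card, hU, Finset.card_biUnion]
  · exact Finset.sum_congr rfl fun H _ => Set.ncard_eq_toFinset_card _
  · intro H hH K hK hne
    refine Finset.disjoint_left.2 fun e heH heK => hne ?_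
    rw [Set.Finite.mem_toFinset] at heH heK
    exact (h e (H.edgeSet_subset heH)).unique ⟨hH, heH⟩ ⟨hK, heK⟩

theorem IsStarDecomposition.wgt_eq {V : Type} [Finite V] {G : SimpleGraph V}
    {P : Finset G.Subgraph} (h : IsStarDecomposition P) :
    wgt P = G.edgeSet.ncard + P.card := by
  rw [wgt, Finset.sum_congr rfl fun H hH => ncard_verts_of_isStarGraph_coe (h.1 H hH).2,
    Finset.sum_add_distrib, h.2.sum_ncard_edgeSet, Finset.card_eq_sum_ones]

theorem exists_isStarDecomposition_card_le {V : Type} {G : SimpleGraph V} {S : Finset V}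
    (hS : ∀ v w : V, G.Adj v w → v ∈ S ∨ w ∈ S) :
    ∃ P : Finset G.Subgraph, IsStarDecomposition P ∧ P.card ≤ S.card := by
  classical
  have hc (e : Sym2 V) : ∃ v, e ∈ G.edgeSet → v ∈ S ∧ v ∈ e := by
    induction e with
    | h x y =>
      by_cases hxy : G.Adj x y
      · rcases hS x y hxy with h | h
        · exact ⟨x, fun _ => ⟨h, Sym2.mem_mk_left _ _⟩⟩
        · exact ⟨y, fun _ => ⟨h, Sym2.mem_mk_right _ _⟩⟩
      · exact ⟨x, fun h => absurd h hxy⟩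
  choose c hc using hc
  let A (v : V) : Set V := {w | G.Adj v w ∧ c s(v, w) = v}
  let star (v : V) : G.Subgraph := starSubgraph G v (A v) fun _ h => h.1
  have mem_star (v : V) (e : Sym2 V) : e ∈ (star v).edgeSet ↔ ∃ w ∈ A v, e = s(v, w) :=
    mem_edgeSet_starSubgraph _ e
  refine ⟨(S.filter fun v => (A v).Nonempty).image star, ⟨?_, ?_⟩,
    Finset.card_image_le.trans (Finset.card_filter_le _ _)⟩
  · intro H hH
    obtain ⟨v, hv, rfl⟩ := Finset.mem_image.1 hH
    obtain ⟨w, hw⟩ := (Finset.mem_filter.1 hv).2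
    exact ⟨⟨s(v, w), (mem_star v _).2 ⟨w, hw, rfl⟩⟩, isStarGraph_coe_starSubgraph _⟩
  · intro e he
    obtain ⟨hcS, w, hw⟩ := hc e he
    have hwA : w ∈ A (c e) := ⟨by rwa [hw] at he, by rw [← hw]⟩
    refine ⟨star (c e), ⟨Finset.mem_image_of_mem _ (Finset.mem_filter.2 ⟨hcS, w, hwA⟩),
      (mem_star _ _).2 ⟨w, hwA, hw⟩⟩, ?_⟩
    rintro H ⟨hH, heH⟩
    obtain ⟨v, -, rfl⟩ := Finset.mem_image.1 hH
    obtain ⟨x, hx, rfl⟩ := (mem_star v e).1 heH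
    exact congrArg star hx.2.symm

theorem IsStarDecomposition.exists_vertexCover_card_le {V : Type} {G : SimpleGraph V}
    {P : Finset G.Subgraph} (h : IsStarDecomposition P) :
    ∃ S : Finset V, S.card ≤ P.card ∧ ∀ v w : V, G.Adj v w → v ∈ S ∨ w ∈ S := by
  classical
  choose c _ hc using fun H : P => exists_center_of_isStarGraph_coe (h.1 H H.2).2
  refine ⟨P.attach.image c, Finset.card_image_le.trans_eq P.card_attach, fun v w hvw => ?_⟩
  obtain ⟨H, hH, he⟩ := (h.2 s(v, w) hvw).exists
  have hmem : c ⟨H, hH⟩ ∈ P.attach.image c := Finset.mem_image_of_mem _ (P.mem_attach _)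
  rw [hc ⟨H, hH⟩] at he
  obtain ⟨x, -, hx⟩ := he
  rcases Sym2.eq_iff.1 hx with ⟨rfl, -⟩ | ⟨rfl, -⟩
  · exact Or.inl hmem
  · exact Or.inr hmem


/-- Let `G` be a finite simple graph without isolated vertices, with `m`
edges, and let `k` be a positive integer.  Then `G` has a vertex cover of size at most
`k` if and only if `G` admits a star decomposition `P` with `wgt P ≤ m + k`. -/
theorem vertexCover_iff_starDecomposition {V : Type} [Fintype V] (G : SimpleGraph V)
    (hni : ∀ v : V, ∃ w : V, G.Adj v w) (k : ℕ) (hk : 0 < k) :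
    (∃ S : Finset V, S.card ≤ k ∧ ∀ v w : V, G.Adj v w → v ∈ S ∨ w ∈ S) ↔
      ∃ P : Finset G.Subgraph, IsStarDecomposition P ∧ wgt P ≤ G.edgeSet.ncard + k := by
  constructor
  · rintro ⟨S, hSk, hS⟩
    obtain ⟨P, hP, hPS⟩ := exists_isStarDecomposition_card_le hS
    exact ⟨P, hP, hP.wgt_eq.trans_le (by omega)⟩
  · rintro ⟨P, hP, hPk⟩
    obtain ⟨S, hSP, hS⟩ := hP.exists_vertexCover_card_le
    rw [hP.wgt_eq] at hPk
    exact ⟨S, by omega, hS⟩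
end

section
/- Let Γ be a family of connected graphs, let G be a finite simple graph without isolated vertices, let α be an integer, and let P be a Γ-decomposition of G with wgt(P) ≤ |V(G)| + α. Then either G is a disjoint union of graphs isomorphic to members of Γ, or there exists a vertex u of G that can be exclusively split to obtain a graph G' such that: (1) G' admits a Γ-decomposition P', (2) wgt(P') ≤ |V(G')| + α − 1, and (3) G' has no isolated vertices. -/
open SimpleGraph

section Reglue

variable {V W ι : Type} {G : SimpleGraph V}

/-- The union of the members of `P`, where the vertices of each member `K` are renamed
along `φ K`. -/
def reglue (P : Finset G.Subgraph) (φ : G.Subgraph → V ↪ W) : SimpleGraph W :=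
  ⨆ K ∈ P, K.spanningCoe.map (φ K)

lemma reglue_adj {P : Finset G.Subgraph} {φ : G.Subgraph → V ↪ W} {a b : W} :
    (reglue P φ).Adj a b ↔ ∃ K ∈ P, ∃ x y, K.Adj x y ∧ φ K x = a ∧ φ K y = b := by
  simp [reglue, SimpleGraph.iSup_adj, SimpleGraph.map_adj]

/-- The copy of the member `K` of `P` inside `reglue P φ`. -/
def reglueMember (P : Finset G.Subgraph) (φ : G.Subgraph → V ↪ W) (K : {K // K ∈ P}) :
    (reglue P φ).Subgraph where
  verts := φ K '' K.1.verts
  Adj a b := ∃ x y, K.1.Adj x y ∧ φ K x = a ∧ φ K y = b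
  adj_sub := fun ⟨x, y, h, hx, hy⟩ => reglue_adj.2 ⟨K, K.2, x, y, h, hx, hy⟩
  edge_vert := fun ⟨x, _, h, hx, _⟩ => ⟨x, h.fst_mem, hx⟩
  symm := ⟨fun _ _ ⟨x, y, h, hx, hy⟩ => ⟨y, x, h.symm, hy, hx⟩⟩

/-- A member of `P` is isomorphic to its copy in `reglue P φ`. -/
noncomputable def reglueMemberIso (P : Finset G.Subgraph) (φ : G.Subgraph → V ↪ W)
    (K : {K // K ∈ P}) : K.1.coe ≃g (reglueMember P φ K).coe where
  toEquiv := Equiv.Set.image (φ K) K.1.verts (φ K).injective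
  map_rel_iff' := by
    rintro ⟨x, hx⟩ ⟨y, hy⟩
    change (∃ x' y', K.1.Adj x' y' ∧ φ K x' = φ K x ∧ φ K y' = φ K y) ↔ K.1.Adj x y
    simp

open Classical in
/-- The copies in `reglue P φ` of the members of `P`. -/
noncomputable def reglueDecomposition (P : Finset G.Subgraph) (φ : G.Subgraph → V ↪ W) :
    Finset (reglue P φ).Subgraph :=
  P.attach.image (reglueMember P φ)

lemma wgt_reglueDecomposition_le (P : Finset G.Subgraph) (φ : G.Subgraph → V ↪ W) :
    wgt (reglueDecomposition P φ) ≤ wgt P := by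
  classical
  calc wgt (reglueDecomposition P φ)
      ≤ ∑ K ∈ P.attach, (reglueMember P φ K).verts.ncard :=
        Finset.sum_image_le_of_nonneg fun _ _ => Nat.zero_le _
    _ = ∑ K ∈ P.attach, K.1.verts.ncard :=
        Finset.sum_congr rfl fun K _ => Set.ncard_image_of_injective _ (φ K).injective
    _ = wgt P := Finset.sum_attach P fun K => K.verts.ncard

lemma IsEdgeDecomposition.exists_adj {P : Finset G.Subgraph} (hP : IsEdgeDecomposition P)
    {x y : V} (h : G.Adj x y) : ∃ K ∈ P, K.Adj x y := by
  obtain ⟨K, ⟨hK, hxy⟩, -⟩ := hP s(x, y) h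
  exact ⟨K, hK, hxy⟩

lemma IsEdgeDecomposition.eq_of_adj {P : Finset G.Subgraph} (hP : IsEdgeDecomposition P)
    {K L : G.Subgraph} (hK : K ∈ P) (hL : L ∈ P) {x y : V} (hKxy : K.Adj x y)
    (hLxy : L.Adj x y) : K = L :=
  (hP s(x, y) hKxy.adj_sub).unique ⟨hK, hKxy⟩ ⟨hL, hLxy⟩

lemma IsGammaDecomposition.reglue {Γ : ι → (U : Type) × SimpleGraph U}
    {P : Finset G.Subgraph} (hP : IsGammaDecomposition Γ P) {φ : G.Subgraph → V ↪ W}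
    {π : W → V} (hπ : ∀ K x, π (φ K x) = x) :
    IsGammaDecomposition Γ (reglueDecomposition P φ) := by
  refine ⟨fun K' hK' => ?_, fun e => ?_⟩
  · simp only [reglueDecomposition, Finset.mem_image, Finset.mem_attach, true_and] at hK'
    obtain ⟨K, rfl⟩ := hK'
    obtain ⟨⟨e, he⟩, i, ⟨f⟩⟩ := hP.1 K K.2
    refine ⟨?_, i, ⟨(reglueMemberIso P φ K).symm.trans f⟩⟩
    induction e with | _ x y => exact ⟨s(φ K x, φ K y), x, y, he, rfl, rfl⟩
  · induction e with | _ a b =>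
    intro he
    obtain ⟨K, hK, x, y, hxy, rfl, rfl⟩ := reglue_adj.1 he
    refine ⟨reglueMember P φ ⟨K, hK⟩, ⟨?_, x, y, hxy, rfl, rfl⟩, ?_⟩
    · simp [reglueDecomposition]
    · rintro L' ⟨hL', hadj⟩
      simp only [reglueDecomposition, Finset.mem_image, Finset.mem_attach, true_and] at hL'
      obtain ⟨L, rfl⟩ := hL'
      obtain ⟨x', y', hxy', hx, hy⟩ := hadj
      have hx' : x' = x := by rw [← hπ L x', hx, hπ]
      have hy' : y' = y := by rw [← hπ L y', hy, hπ]
      subst hx' hy'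
      congr 1
      exact Subtype.ext (hP.2.eq_of_adj L.2 hK hxy' hxy)

end Reglue

section Split

variable {V ι : Type} {G : SimpleGraph V}

lemma IsGammaDecomposition.connected {Γ : ι → (W : Type) × SimpleGraph W}
    (hΓ : ∀ i, (Γ i).2.Connected) {P : Finset G.Subgraph} (hP : IsGammaDecomposition Γ P)
    {H : G.Subgraph} (hH : H ∈ P) : H.Connected := by
  obtain ⟨-, i, ⟨f⟩⟩ := hP.1 H hH
  exact ⟨f.connected_iff.2 (hΓ i)⟩

lemma IsGammaDecomposition.exists_adj_of_mem {Γ : ι → (W : Type) × SimpleGraph W}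
    (hΓ : ∀ i, (Γ i).2.Connected) {P : Finset G.Subgraph} (hP : IsGammaDecomposition Γ P)
    {H : G.Subgraph} (hH : H ∈ P) {u : V} (hu : u ∈ H.verts) : ∃ w, H.Adj u w := by
  have hconn := (hP.connected hΓ hH).coe
  obtain ⟨e, he⟩ := (hP.1 H hH).1
  induction e with | _ x y =>
  have : Nontrivial H.verts :=
    ⟨⟨x, H.edge_vert he⟩, ⟨y, (he : H.Adj x y).snd_mem⟩, fun h =>
      (H.adj_sub he).ne (congrArg Subtype.val h)⟩
  obtain ⟨w, hw⟩ := hconn.preconnected.exists_adj_of_nontrivial ⟨u, hu⟩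
  exact ⟨w, hw⟩

lemma isDisjointUnionOf_of_unique_mem {Γ : ι → (W : Type) × SimpleGraph W}
    (hΓ : ∀ i, (Γ i).2.Connected) (hni : ∀ v, ∃ w, G.Adj v w) {P : Finset G.Subgraph}
    (hP : IsGammaDecomposition Γ P)
    (huniq : ∀ u, ∀ H ∈ P, ∀ K ∈ P, u ∈ H.verts → u ∈ K.verts → H = K) :
    IsDisjointUnionOf Γ G := by
  intro C
  induction C using ConnectedComponent.ind with | _ c =>
  obtain ⟨d, hcd⟩ := hni c
  obtain ⟨H, hH, hcdH⟩ := hP.2.exists_adj hcd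
  have hc : c ∈ H.verts := hcdH.fst_mem
  have hadj : ∀ {a b}, a ∈ H.verts → G.Adj a b → H.Adj a b := by
    intro a b ha hab
    obtain ⟨K, hK, hKab⟩ := hP.2.exists_adj hab
    rwa [huniq a H hH K hK ha hKab.fst_mem]
  have hverts : H.verts = (G.connectedComponentMk c).supp := by
    ext a
    rw [ConnectedComponent.mem_supp_iff, ConnectedComponent.eq]
    refine ⟨fun ha => ?_, fun h => ?_⟩
    · exact ((hP.connected hΓ hH).coe.preconnected ⟨a, ha⟩ ⟨c, hc⟩).map H.hom
    · obtain ⟨p⟩ := h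
      clear hcd hcdH
      induction p with
      | nil => exact hc
      | cons h p ih => exact (hadj (ih hc) h.symm).snd_mem
  obtain ⟨-, i, ⟨f⟩⟩ := hP.1 H hH
  let g : H.coe ≃g G.induce (G.connectedComponentMk c).supp :=
    { toEquiv := Equiv.setCongr hverts
      map_rel_iff' := fun {a _} => ⟨fun h => hadj a.2 h, fun h => H.adj_sub h⟩ }
  exact ⟨i, ⟨g.symm.trans f⟩⟩

open Classical in
/-- The embedding of `V` into `Option V` that sends `u` to the second copy `none`. -/
noncomputable def embedSecondCopy (u : V) : V ↪ Option V where
  toFun x := if x = u then none else some x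
  inj' x y := by
    dsimp only
    split_ifs <;> simp_all

lemma embedSecondCopy_self (u : V) : embedSecondCopy u u = none :=
  if_pos rfl

lemma embedSecondCopy_of_ne {u x : V} (hx : x ≠ u) : embedSecondCopy u x = some x :=
  if_neg hx

open Classical in
/-- The renaming of vertices that attaches `H` to the first copy of `u` and every other
subgraph to the second copy. -/
noncomputable def splitOff (H : G.Subgraph) (u : V) (K : G.Subgraph) : V ↪ Option V :=
  if K = H then Function.Embedding.some else embedSecondCopy u

lemma getD_splitOff (H : G.Subgraph) (u : V) (K : G.Subgraph) (x : V) :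
    (splitOff H u K x).getD u = x := by
  by_cases hK : K = H <;> by_cases hx : x = u <;>
    simp [splitOff, embedSecondCopy_self, embedSecondCopy_of_ne, hK, hx]

lemma splitOff_of_ne (H : G.Subgraph) {u x : V} (hx : x ≠ u) (K : G.Subgraph) :
    splitOff H u K x = some x := by
  by_cases hK : K = H <;> simp [splitOff, embedSecondCopy_of_ne, hK, hx]

lemma splitOff_self (H : G.Subgraph) (u : V) : splitOff H u H u = some u := by
  simp [splitOff]

lemma splitOff_self_of_ne {H K : G.Subgraph} (h : K ≠ H) (u : V) :
    splitOff H u K u = none := by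
  simp [splitOff, embedSecondCopy_self, h]

lemma reglue_splitOff_adj {P : Finset G.Subgraph} {H : G.Subgraph} {u : V}
    {a b : Option V} : (reglue P (splitOff H u)).Adj a b ↔
      ∃ K ∈ P, K.Adj (a.getD u) (b.getD u) ∧ splitOff H u K (a.getD u) = a ∧
        splitOff H u K (b.getD u) = b := by
  rw [reglue_adj]
  constructor
  · rintro ⟨K, hK, x, y, hxy, rfl, rfl⟩
    exact ⟨K, hK, by simpa only [getD_splitOff, and_self, and_true] using hxy⟩
  · rintro ⟨K, hK, hxy, hx, hy⟩
    exact ⟨K, hK, _, _, hxy, hx, hy⟩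

lemma isExclusiveSplit_reglue_splitOff {P : Finset G.Subgraph} (hP : IsEdgeDecomposition P)
    (H : G.Subgraph) (u : V) : IsExclusiveSplit G (reglue P (splitOff H u)) u := by
  have hsub : ∀ {a b}, (reglue P (splitOff H u)).Adj a b → G.Adj (a.getD u) (b.getD u) := by
    intro a b h
    obtain ⟨K, -, hab, -⟩ := reglue_splitOff_adj.1 h
    exact hab.adj_sub
  refine ⟨⟨fun x y hx hy => ⟨fun h => hsub h, fun h => ?_⟩, fun h => (hsub h).ne rfl,
    fun x h => hsub h, fun x h => hsub h, fun x h => ?_⟩, fun x ⟨h₁, h₂⟩ => ?_⟩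
  · obtain ⟨K, hK, hxy⟩ := hP.exists_adj h
    exact reglue_adj.2 ⟨K, hK, x, y, hxy, splitOff_of_ne H hx K, splitOff_of_ne H hy K⟩
  · obtain ⟨K, hK, hux⟩ := hP.exists_adj h
    by_cases hKH : K = H
    · subst hKH
      exact .inl (reglue_adj.2 ⟨K, hK, u, x, hux, splitOff_self K u,
        splitOff_of_ne K h.ne' K⟩)
    · exact .inr (reglue_adj.2 ⟨K, hK, u, x, hux, splitOff_self_of_ne hKH u,
        splitOff_of_ne H h.ne' K⟩)
  · obtain ⟨K, hK, hKux, hKu, -⟩ := reglue_splitOff_adj.1 h₁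
    obtain ⟨L, hL, hLux, hLu, -⟩ := reglue_splitOff_adj.1 h₂
    obtain rfl := hP.eq_of_adj hK hL hKux hLux
    exact Option.some_ne_none u (hKu.symm.trans hLu)

lemma exists_adj_reglue_splitOff {P : Finset G.Subgraph} (hP : IsEdgeDecomposition P)
    (hni : ∀ v, ∃ w, G.Adj v w) {H K : G.Subgraph} (hH : H ∈ P) (hK : K ∈ P) (hKH : K ≠ H)
    {u : V} (hHu : ∃ w, H.Adj u w) (hKu : ∃ w, K.Adj u w) (a : Option V) :
    ∃ b, (reglue P (splitOff H u)).Adj a b := by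
  rcases a with _ | x
  · obtain ⟨w, hw⟩ := hKu
    exact ⟨_, reglue_adj.2 ⟨K, hK, u, w, hw, splitOff_self_of_ne hKH u, rfl⟩⟩
  · by_cases hx : x = u
    · subst hx
      obtain ⟨w, hw⟩ := hHu
      exact ⟨_, reglue_adj.2 ⟨H, hH, x, w, hw, splitOff_self H x, rfl⟩⟩
    · obtain ⟨w, hw⟩ := hni x
      obtain ⟨L, hL, hLw⟩ := hP.exists_adj hw
      exact ⟨_, reglue_adj.2 ⟨L, hL, x, w, hLw, splitOff_of_ne H hx L, rfl⟩⟩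

end Split

/-- Let `Γ` be a family of connected graphs, `G` a finite simple graph
without isolated vertices, `α` an integer, and `P` a `Γ`-decomposition of `G` with
`wgt P ≤ |V(G)| + α`.  Then either `G` is a disjoint union of graphs isomorphic to
members of `Γ`, or some vertex `u` of `G` can be exclusively split to obtain a graph
`G'` admitting a `Γ`-decomposition `P'` with `wgt P' ≤ |V(G')| + α - 1` and with no
isolated vertices. -/
theorem gammaDecomposition_desplitting {V ι : Type} [Fintype V]
    (Γ : ι → (W : Type) × SimpleGraph W) (hΓ : ∀ i : ι, (Γ i).2.Connected)
    (G : SimpleGraph V) (hni : ∀ v : V, ∃ w : V, G.Adj v w)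
    (α : ℤ) (P : Finset G.Subgraph) (hP : IsGammaDecomposition Γ P)
    (hw : (wgt P : ℤ) ≤ (Fintype.card V : ℤ) + α) :
    IsDisjointUnionOf Γ G ∨
      ∃ (u : V) (G' : SimpleGraph (Option V)), IsExclusiveSplit G G' u ∧
        ∃ P' : Finset G'.Subgraph, IsGammaDecomposition Γ P' ∧
          (wgt P' : ℤ) ≤ (Fintype.card (Option V) : ℤ) + α - 1 ∧
          (∀ v' : Option V, ∃ w' : Option V, G'.Adj v' w') := by
  by_cases huniq : ∀ u, ∀ H ∈ P, ∀ K ∈ P, u ∈ H.verts → u ∈ K.verts → H = K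
  · exact .inl (isDisjointUnionOf_of_unique_mem hΓ hni hP huniq)
  · right
    push Not at huniq
    obtain ⟨u, H, hH, K, hK, huH, huK, hne⟩ := huniq
    refine ⟨u, reglue P (splitOff H u), isExclusiveSplit_reglue_splitOff hP.2 H u,
      reglueDecomposition P (splitOff H u), hP.reglue (π := (·.getD u)) (getD_splitOff H u), ?_,
      exists_adj_reglue_splitOff hP.2 hni hH hK hne.symm
        (hP.exists_adj_of_mem hΓ hH huH) (hP.exists_adj_of_mem hΓ hK huK)⟩
    have := wgt_reglueDecomposition_le P (splitOff H u)
    rw [Fintype.card_option]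
    push_cast
    omega
end

section
/- Let G be a finite simple graph and let G' be obtained from G by an inclusive vertex split of a vertex u into two vertices v and w. If P' is a star decomposition of G', then there exists a star decomposition P of G with wgt(P) ≤ wgt(P'). -/
open SimpleGraph

theorem IsStarGraph.exists_center_mem {W : Type} {G : SimpleGraph W} {H : G.Subgraph}
    (hH : IsStarGraph H.coe) : ∃ c : W, ∀ e ∈ H.edgeSet, c ∈ e := by
  obtain ⟨c, hc⟩ := hH
  refine ⟨c, fun e => Sym2.ind (fun a b hab => ?_) e⟩
  have hab' : H.Adj a b := hab
  have h := (hc ⟨a, hab'.fst_mem⟩ ⟨b, hab'.snd_mem⟩).1 hab'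
  rw [Sym2.mem_iff]
  rcases h with ⟨h, -⟩ | ⟨h, -⟩
  · exact Or.inl (congrArg Subtype.val h).symm
  · exact Or.inr (congrArg Subtype.val h).symm

/-- The subgraph of `G` formed by the edges in `S` and their endpoints. -/
def subgraphOfEdges {V : Type} (G : SimpleGraph V) (S : Set (Sym2 V)) : G.Subgraph where
  verts := {a | ∃ b, G.Adj a b ∧ s(a, b) ∈ S}
  Adj a b := G.Adj a b ∧ s(a, b) ∈ S
  adj_sub h := h.1
  edge_vert h := ⟨_, h⟩
  symm := ⟨fun _ _ h => ⟨h.1.symm, Sym2.eq_swap ▸ h.2⟩⟩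

theorem mem_edgeSet_subgraphOfEdges {V : Type} {G : SimpleGraph V} {S : Set (Sym2 V)}
    {e : Sym2 V} : e ∈ (subgraphOfEdges G S).edgeSet ↔ e ∈ G.edgeSet ∧ e ∈ S := by
  induction e with | _ a b => exact Iff.rfl

theorem isStarGraph_subgraphOfEdges {V : Type} {G : SimpleGraph V} {S : Set (Sym2 V)} {c : V}
    (hne : (subgraphOfEdges G S).edgeSet.Nonempty)
    (hc : ∀ e ∈ (subgraphOfEdges G S).edgeSet, c ∈ e) :
    IsStarGraph (subgraphOfEdges G S).coe := by
  have hcv : c ∈ (subgraphOfEdges G S).verts := by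
    obtain ⟨e, he⟩ := hne
    exact Subgraph.mem_verts_of_mem_edge he (hc e he)
  have key : ∀ a b, (subgraphOfEdges G S).Adj a b → c = a ∨ c = b := fun a b hab =>
    Sym2.mem_iff.1 (hc s(a, b) hab)
  have adj_center : ∀ a ∈ (subgraphOfEdges G S).verts, a ≠ c →
      (subgraphOfEdges G S).Adj c a := by
    rintro a ⟨b, hab⟩ hac
    rcases key a b hab with rfl | rfl
    · exact absurd rfl hac
    · exact Subgraph.Adj.symm hab
  refine ⟨⟨c, hcv⟩, ?_⟩
  rintro ⟨a, ha⟩ ⟨b, hb⟩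
  simp only [Subgraph.coe_adj, Subtype.mk.injEq, ne_eq]
  constructor
  · intro hab
    rcases key a b hab with rfl | rfl
    · exact Or.inl ⟨rfl, hab.ne.symm⟩
    · exact Or.inr ⟨rfl, hab.ne⟩
  · rintro (⟨rfl, h⟩ | ⟨rfl, h⟩)
    · exact adj_center b hb h
    · exact (adj_center a ha h).symm

/-- If every edge of `G` lifts along `π` to an edge of `G'`, then a star decomposition of `G'`
induces one of `G` of no larger weight. -/
theorem IsStarDecomposition.exists_of_edge_lift {V W : Type} [Finite W] {G : SimpleGraph V}
    {G' : SimpleGraph W} (π : W → V)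
    (hlift : ∀ e ∈ G.edgeSet, ∃ e' ∈ G'.edgeSet, e'.map π = e)
    {P' : Finset G'.Subgraph} (hP' : IsStarDecomposition P') :
    ∃ P : Finset G.Subgraph, IsStarDecomposition P ∧ wgt P ≤ wgt P' := by
  classical
  obtain hG | ⟨e₀, he₀⟩ := G.edgeSet.eq_empty_or_nonempty
  · exact ⟨∅, ⟨by simp, by simp [IsEdgeDecomposition, hG]⟩, by simp [wgt]⟩
  have : Nonempty (Sym2 W) := ⟨(hlift e₀ he₀).choose⟩
  choose! ψ hψ using hlift
  let T : G'.Subgraph → G.Subgraph := fun H => subgraphOfEdges G (ψ ⁻¹' H.edgeSet)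
  have hT : ∀ H e, e ∈ (T H).edgeSet ↔ e ∈ G.edgeSet ∧ ψ e ∈ H.edgeSet := fun H e =>
    mem_edgeSet_subgraphOfEdges
  have huniq : ∀ H₁ ∈ P', ∀ H₂ ∈ P', ∀ e, e ∈ (T H₁).edgeSet → e ∈ (T H₂).edgeSet →
      H₁ = H₂ := by
    intro H₁ h₁ H₂ h₂ e he₁ he₂
    rw [hT] at he₁ he₂
    exact (hP'.2 (ψ e) (hψ e he₁.1).1).unique ⟨h₁, he₁.2⟩ ⟨h₂, he₂.2⟩
  refine ⟨(P'.filter fun H => (T H).edgeSet.Nonempty).image T, ⟨?_, ?_⟩, ?_⟩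
  · simp only [Finset.mem_image, Finset.mem_filter]
    rintro _ ⟨H, ⟨hH, hne⟩, rfl⟩
    refine ⟨hne, ?_⟩
    obtain ⟨c, hc⟩ := (hP'.1 H hH).2.exists_center_mem
    refine isStarGraph_subgraphOfEdges (c := π c) hne fun e he => ?_
    obtain ⟨heG, heH⟩ := (hT H e).1 he
    rw [← (hψ e heG).2]
    exact Sym2.mem_map.2 ⟨c, hc _ heH, rfl⟩
  · intro e he
    obtain ⟨H, ⟨hH, heH⟩, -⟩ := hP'.2 (ψ e) (hψ e he).1
    have heT := (hT H e).2 ⟨he, heH⟩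
    refine ⟨T H, ⟨Finset.mem_image_of_mem T (Finset.mem_filter.2 ⟨hH, e, heT⟩), heT⟩, ?_⟩
    rintro _ ⟨hK, heK⟩
    obtain ⟨K, hKP, rfl⟩ := Finset.mem_image.1 hK
    rw [huniq K (Finset.mem_filter.1 hKP).1 H hH e heK heT]
  · unfold wgt
    rw [Finset.sum_image]
    · refine (Finset.sum_le_sum fun H _ => ?_).trans
        (Finset.sum_le_sum_of_subset (Finset.filter_subset _ _))
      refine (Set.ncard_le_ncard (t := π '' H.verts) ?_ (Set.toFinite _)).trans
        (Set.ncard_image_le (Set.toFinite _))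
      rintro a ⟨b, hab, hH⟩
      have ha : a ∈ (ψ s(a, b)).map π := by
        rw [(hψ s(a, b) hab).2]
        exact Sym2.mem_mk_left a b
      obtain ⟨x, hx, rfl⟩ := Sym2.mem_map.1 ha
      exact ⟨x, Subgraph.mem_verts_of_mem_edge hH hx, rfl⟩
    · intro H₁ h₁ H₂ h₂ h
      obtain ⟨h₁, e, he⟩ := Finset.mem_filter.1 h₁
      exact huniq H₁ h₁ H₂ (Finset.mem_filter.1 h₂).1 e he (h ▸ he)

theorem IsInclusiveSplit.exists_edge_lift {V : Type} {G : SimpleGraph V}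
    {G' : SimpleGraph (Option V)} {u : V} (hsplit : IsInclusiveSplit G G' u) :
    ∀ e ∈ G.edgeSet, ∃ e' ∈ G'.edgeSet, e'.map (fun o => o.getD u) = e := by
  obtain ⟨hadj, -, -, -, hcover⟩ := hsplit
  have lift_at : ∀ x, G.Adj u x →
      ∃ e' ∈ G'.edgeSet, e'.map (fun o => o.getD u) = s(u, x) := by
    intro x hx
    rcases hcover x hx with h | h
    · exact ⟨s(some u, some x), h, rfl⟩
    · exact ⟨s(none, some x), h, rfl⟩
  intro e
  induction e with | _ a b => ?_
  intro hab
  by_cases ha : a = u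
  · subst ha
    exact lift_at b hab
  by_cases hb : b = u
  · subst hb
    rw [Sym2.eq_swap]
    exact lift_at a (G.adj_symm hab)
  exact ⟨s(some a, some b), (hadj a b ha hb).2 hab, rfl⟩

/-- Let `G'` be obtained from `G` by an inclusive vertex split of a
vertex `u` into two vertices.  If `P'` is a star decomposition of `G'`, then there
exists a star decomposition `P` of `G` with `wgt P ≤ wgt P'`. -/
theorem starDecomposition_of_inclusiveSplit {V : Type} [Fintype V] (G : SimpleGraph V)
    (u : V) (G' : SimpleGraph (Option V)) (hsplit : IsInclusiveSplit G G' u)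
    (P' : Finset G'.Subgraph) (hP' : IsStarDecomposition P') :
    ∃ P : Finset G.Subgraph, IsStarDecomposition P ∧ wgt P ≤ wgt P' := by
  exact hP'.exists_of_edge_lift _ hsplit.exists_edge_lift
end

section
/- Let G be a finite simple graph without isolated vertices and let k be a positive integer. Then G can be transformed into a constellation by a sequence of at most k inclusive vertex splits if and only if G admits a star decomposition P with wgt(P) ≤ |V(G)| + k. -/
open SimpleGraph

/-- A constellation is described by a map `c` sending each vertex to the center of its star. -/
theorem isConstellation_iff_exists_center {W : Type} (H : SimpleGraph W) :
    IsConstellation H ↔ ∃ c : W → W, (∀ v, c (c v) = c v) ∧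
      ∀ v w, H.Adj v w ↔ v ≠ w ∧ (v = c w ∨ w = c v) := by
  constructor
  · intro h
    choose d hd using h
    have hmem : ∀ C, H.connectedComponentMk (d C).1 = C := fun C => (d C).2
    have key : ∀ (C : H.ConnectedComponent) (v w : W), H.connectedComponentMk v = C →
        H.connectedComponentMk w = C →
        (H.Adj v w ↔ (v = (d C).1 ∧ w ≠ (d C).1) ∨ (w = (d C).1 ∧ v ≠ (d C).1)) := by
      intro C v w hv hw
      simpa [Subtype.ext_iff] using hd C ⟨v, hv⟩ ⟨w, hw⟩
    refine ⟨fun v => (d (H.connectedComponentMk v)).1,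
      fun v => congrArg (fun C => (d C).1) (hmem _), ?_⟩
    intro v w
    by_cases hvw : H.connectedComponentMk v = H.connectedComponentMk w
    · rw [key _ v w hvw rfl]
      dsimp only
      grind
    · constructor
      · intro h
        exact absurd (ConnectedComponent.sound h.reachable) hvw
      · rintro ⟨-, h | h⟩
        · exact absurd (by rw [h, hmem]) hvw
        · exact absurd (by rw [h, hmem]) hvw
  · rintro ⟨c, hcc, hadj⟩ C
    have hc : ∀ v w, H.Reachable v w → c v = c w := by
      rintro v w ⟨p⟩
      induction p with
      | nil => rfl
      | cons h _ ih =>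
        rw [← ih]
        rcases ((hadj _ _).1 h).2 with h' | h'
        · rw [h', hcc]
        · rw [h', hcc]
    induction C using ConnectedComponent.ind with
    | h v =>
      have hcv : H.connectedComponentMk (c v) = H.connectedComponentMk v := by
        by_cases h : c v = v
        · rw [h]
        · exact ConnectedComponent.sound ((hadj _ _).2 ⟨h, Or.inl rfl⟩).reachable
      refine ⟨⟨c v, hcv⟩, ?_⟩
      rintro ⟨x, hx⟩ ⟨y, hy⟩
      have h1 := hc _ _ (ConnectedComponent.exact hx)
      have h2 := hc _ _ (ConnectedComponent.exact hy)
      simp only [comap_adj, Function.Embedding.subtype_apply, hadj, h1, h2, ne_eq]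
      grind

theorem IsConstellation.of_iso {V W : Type} {H : SimpleGraph W} {G : SimpleGraph V}
    (h : IsConstellation H) (e : H ≃g G) : IsConstellation G := by
  rw [isConstellation_iff_exists_center] at h ⊢
  obtain ⟨c, hcc, hadj⟩ := h
  refine ⟨fun v => e (c (e.symm v)), fun v => by simp [hcc], fun v w => ?_⟩
  rw [← e.symm.map_adj_iff, hadj, e.symm.injective.ne_iff, ← e.injective.eq_iff,
    ← e.injective.eq_iff (a := e.symm w)]
  simp

/-- Graphs reachable by inclusive splits map onto the original graph, every edge being lifted. -/
theorem InclReach.exists_edge_lifting {P : (W : Type) → SimpleGraph W → Prop} {k : ℕ} :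
    ∀ {V : Type} [Fintype V] {G : SimpleGraph V}, InclReach P k V G →
      ∃ (W : Type) (_ : Fintype W) (H : SimpleGraph W) (π : W → V), P W H ∧
        Fintype.card W ≤ Fintype.card V + k ∧ (∀ a b, H.Adj a b → G.Adj (π a) (π b)) ∧
        ∀ x y, G.Adj x y → ∃ a b, H.Adj a b ∧ π a = x ∧ π b = y := by
  induction k with
  | zero =>
    intro V _ G h
    exact ⟨V, inferInstance, G, id, h, le_rfl, fun _ _ h => h,
      fun x y h => ⟨x, y, h, rfl, rfl⟩⟩
  | succ k ih =>
    rintro V _ G (h | ⟨u, G', ⟨h1, h2, h3, h4, h5⟩, h⟩)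
    · exact ⟨V, inferInstance, G, id, h, by omega, fun _ _ h => h,
        fun x y h => ⟨x, y, h, rfl, rfl⟩⟩
    · obtain ⟨W, hW, H, π, hP, hcard, hhom, hlift⟩ := ih h
      have hproj : ∀ p q, G'.Adj p q → G.Adj (p.getD u) (q.getD u) := by
        rintro (_ | x) (_ | y) hpq
        · exact absurd hpq G'.irrefl
        · exact h4 y hpq
        · exact (h4 x hpq.symm).symm
        · by_cases hx : x = u
          · subst hx; exact h3 y hpq
          · by_cases hy : y = u
            · subst hy; exact (h3 x hpq.symm).symm
            · exact (h1 x y hx hy).1 hpq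
      have hl : ∀ x y, G.Adj x y → ∃ p q, G'.Adj p q ∧ p.getD u = x ∧ q.getD u = y := by
        intro x y hxy
        by_cases hx : x = u
        · subst hx
          rcases h5 y hxy with h | h
          · exact ⟨_, _, h, rfl, rfl⟩
          · exact ⟨_, _, h, rfl, rfl⟩
        · by_cases hy : y = u
          · subst hy
            rcases h5 x hxy.symm with h | h
            · exact ⟨_, _, h.symm, rfl, rfl⟩
            · exact ⟨_, _, h.symm, rfl, rfl⟩
          · exact ⟨_, _, (h1 x y hx hy).2 hxy, rfl, rfl⟩
      refine ⟨W, hW, H, fun a => (π a).getD u, hP, ?_, fun a b h => hproj _ _ (hhom a b h), ?_⟩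
      · rw [Fintype.card_option] at hcard
        omega
      · intro x y hxy
        obtain ⟨p, q, hpq, rfl, rfl⟩ := hl x y hxy
        obtain ⟨a, b, hab, rfl, rfl⟩ := hlift p q hpq
        exact ⟨a, b, hab, rfl, rfl⟩

/-- Any vertex-surjective homomorphism lifting all edges is realized by inclusive splits. -/
theorem inclReach_of_edge_lifting {P : (W : Type) → SimpleGraph W → Prop}
    (hiso : ∀ {V W : Type} {H : SimpleGraph W} {G : SimpleGraph V},
      P W H → Nonempty (H ≃g G) → P V G)
    {W : Type} [Fintype W] {H : SimpleGraph W} (hP : P W H) {k : ℕ} :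
    ∀ {V : Type} [Fintype V] {G : SimpleGraph V} (π : W → V), Function.Surjective π →
      Fintype.card W ≤ Fintype.card V + k → (∀ a b, H.Adj a b → G.Adj (π a) (π b)) →
      (∀ x y, G.Adj x y → ∃ a b, H.Adj a b ∧ π a = x ∧ π b = y) → InclReach P k V G := by
  have hbij : ∀ {V : Type} {G : SimpleGraph V} (π : W → V), Function.Bijective π →
      (∀ a b, H.Adj a b → G.Adj (π a) (π b)) →
      (∀ x y, G.Adj x y → ∃ a b, H.Adj a b ∧ π a = x ∧ π b = y) → P V G := by
    intro V G π hπ hhom hlift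
    refine hiso hP ⟨⟨Equiv.ofBijective π hπ, ?_⟩⟩
    intro a b
    refine ⟨fun h => ?_, hhom a b⟩
    obtain ⟨a', b', hab, ha, hb⟩ := hlift _ _ h
    rwa [hπ.1 ha, hπ.1 hb] at hab
  induction k with
  | zero =>
    intro V _ G π hsurj hcard hhom hlift
    exact hbij π ((Fintype.bijective_iff_surjective_and_card π).2
      ⟨hsurj, le_antisymm hcard (Fintype.card_le_of_surjective π hsurj)⟩) hhom hlift
  | succ k ih =>
    intro V _ G π hsurj hcard hhom hlift
    by_cases hinj : Function.Injective π
    · exact Or.inl (hbij π ⟨hinj, hsurj⟩ hhom hlift)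
    right
    obtain ⟨w₁, w₂, hw, hne⟩ := Function.not_injective_iff.1 hinj
    classical
    let ρ : W → Option V := fun a => if a = w₂ then none else some (π a)
    have hρ : ∀ a, (ρ a).getD (π w₂) = π a := by
      intro a
      by_cases h : a = w₂ <;> simp [ρ, h]
    let G' : SimpleGraph (Option V) :=
      { Adj := fun p q => ∃ a b, H.Adj a b ∧ ρ a = p ∧ ρ b = q
        symm := ⟨by
          rintro _ _ ⟨a, b, h, rfl, rfl⟩
          exact ⟨b, a, h.symm, rfl, rfl⟩⟩
        loopless := ⟨by
          rintro p ⟨a, b, h, h1, h2⟩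
          have h' := hhom a b h
          rw [← hρ a, ← hρ b, h1, h2] at h'
          exact G.irrefl h'⟩ }
    have hproj : ∀ p q, G'.Adj p q → G.Adj (p.getD (π w₂)) (q.getD (π w₂)) := by
      rintro _ _ ⟨a, b, h, rfl, rfl⟩
      rw [hρ, hρ]
      exact hhom a b h
    have hsome : ∀ a, π a ≠ π w₂ → ρ a = some (π a) := by
      intro a ha
      have : a ≠ w₂ := fun h => ha (by rw [h])
      simp [ρ, this]
    refine ⟨π w₂, G', ⟨?_, ?_, ?_, ?_, ?_⟩, ih ρ ?_ ?_ ?_ ?_⟩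
    · intro x y hx hy
      refine ⟨fun h => hproj _ _ h, fun h => ?_⟩
      obtain ⟨a, b, hab, rfl, rfl⟩ := hlift x y h
      exact ⟨a, b, hab, hsome a hx, hsome b hy⟩
    · exact fun h => G.irrefl (hproj (some (π w₂)) none h)
    · exact fun x h => hproj _ _ h
    · exact fun x h => hproj _ _ h
    · intro x h
      obtain ⟨a, b, hab, ha, rfl⟩ := hlift _ x h
      have hb : ρ b = some (π b) := hsome b h.ne'
      by_cases haw : a = w₂
      · exact Or.inr ⟨a, b, hab, by simp [ρ, haw], hb⟩
      · exact Or.inl ⟨a, b, hab, by simp [ρ, haw, ha], hb⟩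
    · rintro (_ | v)
      · exact ⟨w₂, by simp [ρ]⟩
      · by_cases hv : v = π w₂
        · exact ⟨w₁, by simp [ρ, hne, hw, hv]⟩
        · obtain ⟨a, rfl⟩ := hsurj v
          exact ⟨a, hsome a hv⟩
    · rw [Fintype.card_option]
      omega
    · exact fun a b h => ⟨a, b, h, rfl, rfl⟩
    · exact fun x y h => h

/-- The edges labelled `w` by `f`, together with their endpoints. -/
def labelSubgraph {V W : Type} (G : SimpleGraph V) (f : Sym2 V → W) (w : W) : G.Subgraph where
  verts := {x | ∃ y, G.Adj x y ∧ f s(x, y) = w}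
  Adj x y := G.Adj x y ∧ f s(x, y) = w
  adj_sub h := h.1
  edge_vert h := ⟨_, h⟩
  symm := ⟨fun x y h => ⟨h.1.symm, by rw [Sym2.eq_swap]; exact h.2⟩⟩

theorem mem_edgeSet_labelSubgraph {V W : Type} {G : SimpleGraph V} {f : Sym2 V → W} {w : W}
    {e : Sym2 V} : e ∈ (labelSubgraph G f w).edgeSet ↔ e ∈ G.edgeSet ∧ f e = w := by
  induction e with
  | h x y => rfl

theorem exists_starDecomposition_of_edge_lifting {V W : Type} [Fintype W]
    {G : SimpleGraph V} {H : SimpleGraph W} (hH : IsConstellation H) (π : W → V)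
    (hlift : ∀ x y, G.Adj x y → ∃ a b, H.Adj a b ∧ π a = x ∧ π b = y) :
    ∃ P : Finset G.Subgraph, IsStarDecomposition P ∧ wgt P ≤ Fintype.card W := by
  classical
  obtain ⟨c, hcc, hadj⟩ := (isConstellation_iff_exists_center H).1 hH
  rcases isEmpty_or_nonempty W with hW | hW
  · refine ⟨∅, ⟨by simp, fun e he => ?_⟩, by simp [wgt]⟩
    induction e with
    | h x y => exact isEmptyElim (hlift x y he).choose
  have hex : ∀ e ∈ G.edgeSet, ∃ w, c w = w ∧ ∃ l, c l = w ∧ e = s(π w, π l) := by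
    intro e he
    induction e with
    | h x y =>
      obtain ⟨a, b, hab, rfl, rfl⟩ := hlift x y he
      rcases ((hadj a b).1 hab).2 with h | h
      · exact ⟨a, by rw [h, hcc], b, h.symm, rfl⟩
      · exact ⟨b, by rw [h, hcc], a, h.symm, Sym2.eq_swap⟩
  choose! f hfc l hl hf using hex
  have hcenter : ∀ w x y, (labelSubgraph G f w).Adj x y → x = π w ∨ y = π w := by
    rintro w x y ⟨hxy, rfl⟩
    have := hf s(x, y) hxy
    rw [Sym2.eq_iff] at this
    tauto
  have hverts : ∀ w, (labelSubgraph G f w).verts ⊆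
      ↑((Finset.univ.filter fun a => c a = w).image π) := by
    rintro w x ⟨y, hxy, rfl⟩
    have hx : x ∈ s(π (f s(x, y)), π (l s(x, y))) := by
      rw [← hf s(x, y) hxy]
      exact Sym2.mem_mk_left x y
    simp only [Finset.coe_image, Finset.coe_filter, Finset.mem_univ, true_and]
    rcases Sym2.mem_iff.1 hx with h | h
    · exact ⟨_, hfc s(x, y) hxy, h.symm⟩
    · exact ⟨_, hl s(x, y) hxy, h.symm⟩
  refine ⟨(Finset.univ.filter fun w => (labelSubgraph G f w).edgeSet.Nonempty).image
    (labelSubgraph G f), ⟨?_, ?_⟩, ?_⟩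
  · intro S hS
    simp only [Finset.mem_image, Finset.mem_filter, Finset.mem_univ, true_and] at hS
    obtain ⟨w, hne, rfl⟩ := hS
    refine ⟨hne, ?_⟩
    obtain ⟨e, he⟩ := hne
    have hw : π w ∈ (labelSubgraph G f w).verts := by
      induction e with
      | h x y =>
        rcases hcenter w x y he with rfl | rfl
        · exact ⟨_, he⟩
        · exact (labelSubgraph G f w).edge_vert (Subgraph.Adj.symm he)
    have hspoke : ∀ x ∈ (labelSubgraph G f w).verts, x ≠ π w →
        (labelSubgraph G f w).Adj x (π w) := by
      rintro x ⟨y, hxy⟩ hx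
      rcases hcenter w x y hxy with h | rfl
      · exact absurd h hx
      · exact hxy
    refine ⟨⟨π w, hw⟩, ?_⟩
    rintro ⟨x, hx⟩ ⟨y, hy⟩
    simp only [Subgraph.coe_adj, Subtype.mk.injEq, ne_eq]
    constructor
    · intro h
      have hne := h.ne
      rcases hcenter w x y h with rfl | rfl
      · exact Or.inl ⟨rfl, hne.symm⟩
      · exact Or.inr ⟨rfl, hne⟩
    · rintro (⟨rfl, h⟩ | ⟨rfl, h⟩)
      · exact (hspoke y hy h).symm
      · exact hspoke x hx h
  · intro e he
    refine ⟨labelSubgraph G f (f e), ⟨?_, mem_edgeSet_labelSubgraph.2 ⟨he, rfl⟩⟩, ?_⟩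
    · exact Finset.mem_image_of_mem _ (by
        simpa using ⟨e, mem_edgeSet_labelSubgraph.2 ⟨he, rfl⟩⟩)
    · rintro S ⟨hS, heS⟩
      obtain ⟨w, -, rfl⟩ := Finset.mem_image.1 hS
      rw [(mem_edgeSet_labelSubgraph.1 heS).2]
  · calc wgt _ ≤ ∑ w with (labelSubgraph G f w).edgeSet.Nonempty,
          (labelSubgraph G f w).verts.ncard :=
          Finset.sum_image_le_of_nonneg fun _ _ => Nat.zero_le _
      _ ≤ ∑ w, (labelSubgraph G f w).verts.ncard :=
          Finset.sum_le_sum_of_subset (Finset.filter_subset _ _)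
      _ ≤ ∑ w, (Finset.univ.filter fun a => c a = w).card := by
          refine Finset.sum_le_sum fun w _ => ?_
          refine (Set.ncard_le_ncard (hverts w) (Finset.finite_toSet _)).trans ?_
          rw [Set.ncard_coe_finset]
          exact Finset.card_image_le
      _ = Fintype.card W :=
          (Finset.card_eq_sum_card_fiberwise fun _ _ => Finset.mem_univ _).symm

theorem IsStarDecomposition.inclReach {V : Type} [Fintype V] {G : SimpleGraph V}
    (hni : ∀ v, ∃ w, G.Adj v w) {P : Finset G.Subgraph} (hP : IsStarDecomposition P) {k : ℕ}
    (hk : wgt P ≤ Fintype.card V + k) : InclReach (fun _ H => IsConstellation H) k V G := by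
  classical
  obtain ⟨hstar, hdec⟩ := hP
  choose d hd using fun S : P => (hstar S.1 S.2).2
  let c : (Σ S : P, S.1.verts) → Σ S : P, S.1.verts := fun a => ⟨a.1, d a.1⟩
  let H : SimpleGraph (Σ S : P, S.1.verts) :=
    { Adj := fun a b => a ≠ b ∧ (a = c b ∨ b = c a)
      symm := ⟨fun a b h => ⟨h.1.symm, h.2.symm⟩⟩
      loopless := ⟨fun a h => h.1 rfl⟩ }
  have hadj : ∀ (S : P) (x y : S.1.verts), H.Adj ⟨S, x⟩ ⟨S, y⟩ ↔ S.1.Adj x y := by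
    intro S x y
    rw [← Subgraph.coe_adj, hd S]
    simp only [H, c, ne_eq, Sigma.mk.injEq, heq_eq_eq, true_and]
    grind
  have hH : IsConstellation H :=
    (isConstellation_iff_exists_center H).2 ⟨c, fun _ => rfl, fun _ _ => Iff.rfl⟩
  have hlift : ∀ x y, G.Adj x y → ∃ a b : Σ S : P, S.1.verts,
      H.Adj a b ∧ a.2.1 = x ∧ b.2.1 = y := by
    intro x y hxy
    obtain ⟨S, ⟨hS, he⟩, -⟩ := hdec s(x, y) hxy
    have he : S.Adj x y := he
    exact ⟨⟨⟨S, hS⟩, x, he.fst_mem⟩, ⟨⟨S, hS⟩, y, he.snd_mem⟩, (hadj _ _ _).2 he, rfl, rfl⟩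
  refine inclReach_of_edge_lifting (P := fun _ H => IsConstellation H)
    (fun h ⟨e⟩ => h.of_iso e) hH (fun a => a.2.1) ?_ ?_ ?_ hlift
  · intro v
    obtain ⟨w, hvw⟩ := hni v
    obtain ⟨a, -, -, ha, -⟩ := hlift v w hvw
    exact ⟨a, ha⟩
  · convert hk
    rw [Fintype.card_sigma, wgt, ← Finset.sum_coe_sort P]
    exact Finset.sum_congr rfl fun S _ => by
      rw [← Nat.card_eq_fintype_card, Nat.card_coe_set_eq]
  · rintro ⟨S, x⟩ ⟨T, y⟩ h
    obtain rfl : S = T := by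
      rcases h.2 with h | h
      · exact congrArg Sigma.fst h
      · exact (congrArg Sigma.fst h).symm
    exact ((hadj S x y).1 h).adj_sub

/-- Let `G` be a finite simple graph without isolated vertices and `k`
a positive integer.  Then `G` can be transformed into a constellation by a sequence of
at most `k` inclusive vertex splits iff `G` admits a star decomposition `P` with
`wgt P ≤ |V(G)| + k`. -/
theorem constellationIVS_iff_starDecomposition {V : Type} [Fintype V]
    (G : SimpleGraph V) (hni : ∀ v : V, ∃ w : V, G.Adj v w) (k : ℕ) (hk : 0 < k) :
    InclReach (fun _ H => IsConstellation H) k V G ↔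
      ∃ P : Finset G.Subgraph, IsStarDecomposition P ∧ wgt P ≤ Fintype.card V + k := by
  constructor
  · intro h
    obtain ⟨W, _, H, π, hH, hcard, -, hlift⟩ := h.exists_edge_lifting
    obtain ⟨P, hP, hw⟩ := exists_starDecomposition_of_edge_lifting hH π hlift
    exact ⟨P, hP, hw.trans hcard⟩
  · rintro ⟨P, hP, hw⟩
    exact hP.inclReach hni hw
end

section
/- If a finite simple graph G can be transformed into a cycle graph by a sequence of exclusive vertex splits, then every vertex of G has even degree. -/
open SimpleGraph

/-- Every vertex of a cycle graph has degree two. -/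
theorem IsCycleGraph.ncard_neighborSet {W : Type} {H : SimpleGraph W} (hH : IsCycleGraph H)
    (v : W) : (H.neighborSet v).ncard = 2 := by
  have hv : v ∈ (H.connectedComponentMk v).supp := rfl
  rw [← (hH (H.connectedComponentMk v)).2 ⟨v, hv⟩,
    ← Set.ncard_image_of_injective _ Subtype.val_injective]
  congr 1
  ext w
  constructor
  · intro hw
    exact ⟨⟨w, ConnectedComponent.sound (Adj.reachable hw.symm)⟩, hw, rfl⟩
  · rintro ⟨w', hw', rfl⟩
    exact hw'

/-- Splitting a vertex other than `v` preserves the degree of `v`. -/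
theorem IsExclusiveSplit.ncard_neighborSet_of_ne {V : Type} {G : SimpleGraph V}
    {G' : SimpleGraph (Option V)} {u v : V} (h : IsExclusiveSplit G G' u) (hv : v ≠ u) :
    (G.neighborSet v).ncard = (G'.neighborSet (some v)).ncard := by
  obtain ⟨⟨hadj, -, hu, hn, hcov⟩, hdisj⟩ := h
  have himage : (fun x : Option V => x.getD u) '' G'.neighborSet (some v) = G.neighborSet v := by
    ext x
    simp only [Set.mem_image, mem_neighborSet]
    constructor
    · rintro ⟨_ | y, hy, rfl⟩
      · exact (hn v hy.symm).symm
      · by_cases hyu : y = u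
        · subst hyu
          exact (hu v hy.symm).symm
        · exact (hadj v y hv hyu).1 hy
    · intro hx
      by_cases hxu : x = u
      · subst hxu
        rcases hcov v hx.symm with h | h
        · exact ⟨some x, h.symm, rfl⟩
        · exact ⟨none, h.symm, rfl⟩
      · exact ⟨some x, (hadj v x hv hxu).2 hx, rfl⟩
  rw [← himage]
  refine Set.InjOn.ncard_image ?_
  rintro (_ | x) hx (_ | y) hy hxy
  · rfl
  · obtain rfl : u = y := hxy
    exact (hdisj v ⟨hy.symm, hx.symm⟩).elim
  · obtain rfl : x = u := hxy
    exact (hdisj v ⟨hx.symm, hy.symm⟩).elim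
  · exact congrArg some hxy

/-- The degree of the split vertex is the sum of the degrees of its two copies. -/
theorem IsExclusiveSplit.ncard_neighborSet_self {V : Type} [Finite V] {G : SimpleGraph V}
    {G' : SimpleGraph (Option V)} {u : V} (h : IsExclusiveSplit G G' u) :
    (G.neighborSet u).ncard =
      (G'.neighborSet (some u)).ncard + (G'.neighborSet none).ncard := by
  obtain ⟨⟨-, hun, hu, hn, hcov⟩, hdisj⟩ := h
  have hdisj' : Disjoint (G'.neighborSet (some u)) (G'.neighborSet none) := by
    rw [Set.disjoint_left]
    rintro (_ | x) hx hy
    · exact hun hx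
    · exact hdisj x ⟨hx, hy⟩
  rw [← Set.ncard_union_eq hdisj',
    ← Set.ncard_image_of_injective (G.neighborSet u) (Option.some_injective V)]
  congr 1
  ext (_ | x)
  · simp [hun]
  · simp only [Set.mem_image, mem_neighborSet, Option.some.injEq, exists_eq_right,
      Set.mem_union]
    exact ⟨hcov x, fun hx => hx.elim (hu x) (hn x)⟩

/-- If all degrees are even after an exclusive split, they were even before it. -/
theorem IsExclusiveSplit.even_ncard_neighborSet {V : Type} [Finite V] {G : SimpleGraph V}
    {G' : SimpleGraph (Option V)} {u : V} (h : IsExclusiveSplit G G' u)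
    (heven : ∀ x, Even (G'.neighborSet x).ncard) (v : V) : Even (G.neighborSet v).ncard := by
  by_cases hv : v = u
  · subst hv
    rw [h.ncard_neighborSet_self]
    exact (heven _).add (heven _)
  · rw [h.ncard_neighborSet_of_ne hv]
    exact heven _

/-- If a finite simple graph `G` can be transformed into a cycle graph
by a sequence of exclusive vertex splits, then every vertex of `G` has even degree. -/
theorem even_degree_of_cycleGraphEVS {V : Type} [Fintype V] (G : SimpleGraph V)
    (h : ∃ k : ℕ, ExclReach (fun _ H => IsCycleGraph H) k V G) :
    ∀ v : V, Even ((G.neighborSet v).ncard) := by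
  obtain ⟨k, hk⟩ := h
  induction k generalizing V with
  | zero => exact fun v => IsCycleGraph.ncard_neighborSet hk v ▸ even_two
  | succ k ih =>
    rcases hk with hG | ⟨u, G', hsplit, hk⟩
    · exact fun v => IsCycleGraph.ncard_neighborSet hG v ▸ even_two
    · exact hsplit.even_ncard_neighborSet (ih G' hk)
end

section
/- Let G be a finite simple graph with n vertices and m edges, without isolated vertices, in which every vertex has even degree, and let k be a nonnegative integer. Then G can be transformed into a cycle graph by a sequence of at most k exclusive vertex splits if and only if k ≥ m − n. -/
open SimpleGraph

/-- A graph is a disjoint union of cycles iff it is `2`-regular. -/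
theorem isCycleGraph_iff {W : Type} (G : SimpleGraph W) :
    IsCycleGraph G ↔ ∀ v, (G.neighborSet v).ncard = 2 := by
  have key (C : G.ConnectedComponent) (v : C.supp) :
      ((G.induce C.supp).neighborSet v).ncard = (G.neighborSet v.1).ncard := by
    rw [← Set.ncard_image_of_injective _ Subtype.val_injective]
    congr 1
    ext w
    simp only [Set.mem_image, mem_neighborSet, Subtype.exists, exists_and_right, exists_eq_right,
      comap_adj, Function.Embedding.subtype_apply]
    refine ⟨fun ⟨_, h⟩ => h, fun h => ⟨?_, h⟩⟩
    exact C.mem_supp_of_adj_mem_supp v.2 h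
  refine ⟨fun h v => ?_, fun h C => ⟨C.connected_toSimpleGraph, fun v => (key C v).trans (h v)⟩⟩
  rw [← (h (G.connectedComponentMk v)).2 ⟨v, rfl⟩, key]

theorem sum_ncard_neighborSet {V : Type} [Fintype V] (G : SimpleGraph V) :
    ∑ v, (G.neighborSet v).ncard = 2 * G.edgeSet.ncard := by
  classical
  rw [← coe_edgeFinset, Set.ncard_coe_finset, ← G.sum_degrees_eq_twice_card_edges]
  refine Finset.sum_congr rfl fun v _ => ?_
  rw [Set.ncard_eq_toFinset_card', ← card_neighborFinset_eq_degree, neighborFinset]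

namespace IsExclusiveSplit

variable {V : Type} {G : SimpleGraph V} {G' : SimpleGraph (Option V)} {u : V}

theorem ncard_neighborSet_some (h : IsExclusiveSplit G G' u) {x : V} (hx : x ≠ u) :
    (G'.neighborSet (some x)).ncard = (G.neighborSet x).ncard := by
  obtain ⟨⟨h1, h2, h3, h4, h5⟩, h6⟩ := h
  have inj : Set.InjOn (fun o : Option V => o.getD u) (G'.neighborSet (some x)) := by
    rintro (_ | a) ha (_ | b) hb hab
    · rfl
    · obtain rfl : u = b := hab
      exact (h6 x ⟨hb.symm, ha.symm⟩).elim
    · obtain rfl : a = u := hab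
      exact (h6 x ⟨ha.symm, hb.symm⟩).elim
    · exact congrArg some hab
  rw [← inj.ncard_image]
  congr 1
  ext y
  simp only [Set.mem_image, mem_neighborSet]
  constructor
  · rintro ⟨_ | a, ha, rfl⟩
    · exact (h4 x ha.symm).symm
    · by_cases hau : a = u
      · subst hau
        exact (h3 x ha.symm).symm
      · exact (h1 x a hx hau).1 ha
  · intro hy
    by_cases hyu : y = u
    · subst hyu
      rcases h5 x hy.symm with h | h
      · exact ⟨some y, h.symm, rfl⟩
      · exact ⟨none, h.symm, rfl⟩
    · exact ⟨some y, (h1 x y hx hyu).2 hy, rfl⟩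

theorem ncard_neighborSet_add [Finite V] (h : IsExclusiveSplit G G' u) :
    (G'.neighborSet (some u)).ncard + (G'.neighborSet none).ncard =
      (G.neighborSet u).ncard := by
  obtain ⟨⟨-, h2, h3, h4, h5⟩, h6⟩ := h
  have disj : Disjoint (G'.neighborSet (some u)) (G'.neighborSet none) := by
    rw [Set.disjoint_left]
    rintro (_ | x) ha hb
    · exact h2 ha
    · exact h6 x ⟨ha, hb⟩
  rw [← Set.ncard_union_eq disj (Set.toFinite _) (Set.toFinite _),
    ← Set.ncard_image_of_injective (G.neighborSet u) (Option.some_injective V)]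
  congr 1
  ext (_ | x)
  · simp [h2]
  · simpa using ⟨fun h => h.elim (h3 x) (h4 x), h5 x⟩

/-- An exclusive split preserves the number of edges. -/
theorem ncard_edgeSet [Fintype V] (h : IsExclusiveSplit G G' u) :
    G'.edgeSet.ncard = G.edgeSet.ncard := by
  classical
  have h1 := sum_ncard_neighborSet G
  have h2 := sum_ncard_neighborSet G'
  rw [Fintype.sum_option, ← Finset.add_sum_erase _ _ (Finset.mem_univ u),
    Finset.sum_congr rfl fun x hx => h.ncard_neighborSet_some (Finset.ne_of_mem_erase hx)] at h2
  rw [← Finset.add_sum_erase _ _ (Finset.mem_univ u)] at h1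
  have h3 := h.ncard_neighborSet_add
  omega

end IsExclusiveSplit

/-- Any set of neighbors of `u` can be moved to the second copy of `u`. -/
theorem exists_isExclusiveSplit {V : Type} (G : SimpleGraph V) (u : V) {S : Set V}
    (hS : S ⊆ G.neighborSet u) :
    ∃ G' : SimpleGraph (Option V), IsExclusiveSplit G G' u ∧
      G'.neighborSet none = some '' S := by
  refine ⟨{
    Adj := fun o p => G.Adj (o.getD u) (p.getD u) ∧
      (o = none → p.getD u ∈ S) ∧ (p = none → o.getD u ∈ S) ∧
      (o = some u → p.getD u ∉ S) ∧ (p = some u → o.getD u ∉ S)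
    symm := ⟨fun o p ⟨h, h1, h2, h3, h4⟩ => ⟨h.symm, h2, h1, h4, h3⟩⟩
    loopless := ⟨fun o h => G.irrefl h.1⟩ }, ⟨⟨?_, ?_, ?_, ?_, ?_⟩, ?_⟩, ?_⟩
  · intro x y hx hy
    simp [hx, hy]
  · simp
  · intro x h
    exact h.1
  · intro x h
    exact h.1
  · intro x h
    have := h.ne'
    simp [h, this, em']
  · rintro x ⟨h, h'⟩
    exact h.2.2.2.1 rfl (h'.2.1 rfl)
  · ext (_ | x)
    · simp
    · have hu : u ∉ S := fun hu => G.irrefl (hS hu)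
      simp only [mem_neighborSet, Set.mem_image, Option.some.injEq, exists_eq_right]
      refine ⟨fun h => h.2.1 trivial, fun h => ⟨hS h, fun _ => h, by simp, by simp, ?_⟩⟩
      rintro -
      exact hu

theorem card_edgeSet_le_of_exclReach (k : ℕ) {V : Type} [Fintype V] (G : SimpleGraph V)
    (h : ExclReach (fun _ H => IsCycleGraph H) k V G) :
    G.edgeSet.ncard ≤ k + Fintype.card V := by
  have base {W : Type} [Fintype W] (H : SimpleGraph W) (hH : IsCycleGraph H) :
      H.edgeSet.ncard = Fintype.card W := by
    have := sum_ncard_neighborSet H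
    simp only [(isCycleGraph_iff H).1 hH, Finset.sum_const, Finset.card_univ, smul_eq_mul] at this
    omega
  induction k generalizing V with
  | zero => exact (base G h).le.trans (Nat.le_add_left _ _)
  | succ k ih =>
    obtain h | ⟨u, G', hs, h⟩ := h
    · exact (base G h).le.trans (Nat.le_add_left _ _)
    · have := ih G' h
      rw [hs.ncard_edgeSet, Fintype.card_option] at this
      omega

theorem exclReach_of_card_edgeSet_le (k : ℕ) {V : Type} [Fintype V] (G : SimpleGraph V)
    (hpos : ∀ v, (G.neighborSet v).ncard ≠ 0) (heven : ∀ v, Even (G.neighborSet v).ncard)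
    (h : G.edgeSet.ncard ≤ k + Fintype.card V) :
    ExclReach (fun _ H => IsCycleGraph H) k V G := by
  have two_le {W : Type} (H : SimpleGraph W) (hp : ∀ v, (H.neighborSet v).ncard ≠ 0)
      (he : ∀ v, Even (H.neighborSet v).ncard) (v : W) : 2 ≤ (H.neighborSet v).ncard := by
    have := hp v
    obtain ⟨r, hr⟩ := he v
    omega
  induction k generalizing V with
  | zero =>
    refine (isCycleGraph_iff G).2 fun v => Eq.symm ?_
    refine (Finset.sum_eq_sum_iff_of_le fun v _ => two_le G hpos heven v).1 ?_ v
      (Finset.mem_univ v)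
    refine (Finset.sum_le_sum fun v _ => two_le G hpos heven v).antisymm ?_
    rw [sum_ncard_neighborSet, Finset.sum_const, Finset.card_univ, smul_eq_mul]
    omega
  | succ k ih =>
    by_cases hc : IsCycleGraph G
    · exact Or.inl hc
    rw [isCycleGraph_iff] at hc
    push Not at hc
    obtain ⟨u, hu⟩ := hc
    have hu2 := two_le G hpos heven u
    obtain ⟨S, hS, hS2⟩ := Set.exists_subset_card_eq hu2
    obtain ⟨G', hs, hnone⟩ := exists_isExclusiveSplit G u hS
    have hnone2 : (G'.neighborSet none).ncard = 2 := by
      rw [hnone, Set.ncard_image_of_injective _ (Option.some_injective V), hS2]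
    have hadd := hs.ncard_neighborSet_add
    obtain ⟨r, hr⟩ := heven u
    refine Or.inr ⟨u, G', hs, ih G' ?_ ?_ ?_⟩
    · rintro (_ | x)
      · omega
      · by_cases hx : x = u
        · subst hx
          omega
        · exact (hs.ncard_neighborSet_some hx).trans_ne (hpos x)
    · rintro (_ | x)
      · simp [hnone2]
      · by_cases hx : x = u
        · subst hx
          exact ⟨r - 1, by omega⟩
        · exact hs.ncard_neighborSet_some hx ▸ heven x
    · rw [hs.ncard_edgeSet, Fintype.card_option]
      omega

/-- Let `G` be a finite simple graph with `n` vertices and `m` edges,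
without isolated vertices, in which every vertex has even degree, and let `k ≥ 0`.
Then `G` can be transformed into a cycle graph by a sequence of at most `k` exclusive
vertex splits iff `k ≥ m - n` (stated additively as `m ≤ k + n`). -/
theorem cycleGraphEVS_iff {V : Type} [Fintype V] (G : SimpleGraph V)
    (hni : ∀ v : V, ∃ w : V, G.Adj v w)
    (heven : ∀ v : V, Even ((G.neighborSet v).ncard)) (k : ℕ) :
    ExclReach (fun _ H => IsCycleGraph H) k V G ↔
      G.edgeSet.ncard ≤ k + Fintype.card V := by
  refine ⟨card_edgeSet_le_of_exclReach k G, exclReach_of_card_edgeSet_le k G (fun v => ?_) heven⟩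
  obtain ⟨w, hw⟩ := hni v
  exact Set.ncard_ne_zero_of_mem (show w ∈ G.neighborSet v from hw)
end

section
/- Let G be a finite simple graph and let W be a closed walk in G of length |W| ≥ 3 that visits every vertex of G and traverses every edge of G at least once. Then there exists a sequence of exactly |W| − |V(G)| inclusive vertex splits transforming G into a single cycle. -/
open SimpleGraph

/-- A surjective map `f` exhibits `G` as the image of the graph `C`: the edges of `G` are exactly
the images of the edges of `C`. -/
structure IsGraphQuotient {ι V : Type} (C : SimpleGraph ι) (G : SimpleGraph V) (f : ι → V) :
    Prop where
  surj : Function.Surjective f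
  adj_iff : ∀ a b, G.Adj a b ↔ ∃ i j, C.Adj i j ∧ f i = a ∧ f j = b

/-- If two distinct vertices `i`, `j` of `C` have the same image, then separating `j` from the
fibre of `f i` is an inclusive split of the quotient graph. -/
lemma IsGraphQuotient.exists_split {ι V : Type} {C : SimpleGraph ι} {G : SimpleGraph V}
    {f : ι → V} (h : IsGraphQuotient C G f) {i j : ι} (hij : i ≠ j) (hf : f i = f j) :
    ∃ (G₁ : SimpleGraph (Option V)) (f₁ : ι → Option V),
      IsInclusiveSplit G G₁ (f j) ∧ IsGraphQuotient C G₁ f₁ := by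
  classical
  have hom : ∀ k l, C.Adj k l → G.Adj (f k) (f l) := fun k l hkl =>
    (h.adj_iff _ _).2 ⟨k, l, hkl, rfl, rfl⟩
  let f₁ : ι → Option V := fun k => if k = j then none else some (f k)
  have none_iff : ∀ k, f₁ k = none ↔ k = j := by simp [f₁]
  have some_iff : ∀ k x, f₁ k = some x ↔ k ≠ j ∧ f k = x := by simp [f₁]
  let G₁ : SimpleGraph (Option V) :=
    { Adj := fun a b => ∃ k l, C.Adj k l ∧ f₁ k = a ∧ f₁ l = b
      symm := ⟨fun a b ⟨k, l, hkl, ha, hb⟩ => ⟨l, k, hkl.symm, hb, ha⟩⟩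
      loopless := ⟨by
        rintro (_ | a) ⟨k, l, hkl, ha, hb⟩
        · rw [none_iff] at ha hb
          exact hkl.ne (ha.trans hb.symm)
        · rw [some_iff] at ha hb
          exact (hom k l hkl).ne (ha.2.trans hb.2.symm)⟩ }
  have adj_def : ∀ a b, G₁.Adj a b ↔ ∃ k l, C.Adj k l ∧ f₁ k = a ∧ f₁ l = b := fun _ _ => Iff.rfl
  refine ⟨G₁, f₁, ⟨?_, ?_, ?_, ?_, ?_⟩, ?_, adj_def⟩
  · intro x y hx hy
    simp only [adj_def, h.adj_iff, some_iff]
    constructor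
    · rintro ⟨k, l, hkl, ⟨-, hk⟩, -, hl⟩
      exact ⟨k, l, hkl, hk, hl⟩
    · rintro ⟨k, l, hkl, rfl, rfl⟩
      exact ⟨k, l, hkl, ⟨ne_of_apply_ne f hx, rfl⟩, ne_of_apply_ne f hy, rfl⟩
  · simp only [adj_def, some_iff, none_iff]
    rintro ⟨k, l, hkl, ⟨-, hk⟩, rfl⟩
    exact (hom k l hkl).ne hk
  · simp only [adj_def, some_iff, h.adj_iff]
    rintro x ⟨k, l, hkl, ⟨-, hk⟩, -, hl⟩
    exact ⟨k, l, hkl, hk, hl⟩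
  · simp only [adj_def, some_iff, none_iff, h.adj_iff]
    rintro x ⟨k, l, hkl, rfl, -, hl⟩
    exact ⟨k, l, hkl, rfl, hl⟩
  · simp only [adj_def, some_iff, none_iff, h.adj_iff]
    rintro x ⟨k, l, hkl, hk, rfl⟩
    have hlj : l ≠ j := by
      rintro rfl
      exact (hom k l hkl).ne hk
    by_cases hkj : k = j
    · exact Or.inr ⟨k, l, hkl, hkj, hlj, rfl⟩
    · exact Or.inl ⟨k, l, hkl, ⟨hkj, hk⟩, hlj, rfl⟩
  · rintro (_ | x)
    · exact ⟨j, (none_iff j).2 rfl⟩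
    · obtain ⟨k, rfl⟩ := h.surj x
      by_cases hkj : k = j
      · exact ⟨i, (some_iff _ _).2 ⟨hij, by rw [hf, hkj]⟩⟩
      · exact ⟨k, (some_iff _ _).2 ⟨hkj, rfl⟩⟩

/-- A quotient graph of `C` can be turned into a copy of `C` by inclusive splits, one for each
vertex of `C` in excess. -/
lemma IsGraphQuotient.exists_inclSeq {ι : Type} [Finite ι] {C : SimpleGraph ι} (k : ℕ) :
    ∀ {V : Type} [Finite V] {G : SimpleGraph V} {f : ι → V}, IsGraphQuotient C G f →
      Nat.card ι = Nat.card V + k →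
      ∃ G' : SimpleGraph (IterOpt k V), InclSeq k V G G' ∧ Nonempty (C ≃g G') := by
  induction k with
  | zero =>
    intro V _ G f h hcard
    have hbij : Function.Bijective f := (Nat.bijective_iff_surjective_and_card f).2 ⟨h.surj, hcard⟩
    refine ⟨G, rfl, ⟨⟨Equiv.ofBijective f hbij, ?_⟩⟩⟩
    intro a b
    change G.Adj (f a) (f b) ↔ C.Adj a b
    rw [h.adj_iff]
    constructor
    · rintro ⟨i, j, hij, hi, hj⟩
      rwa [← hbij.1 hi, ← hbij.1 hj]
    · exact fun hab => ⟨a, b, hab, rfl, rfl⟩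
  | succ k ih =>
    intro V _ G f h hcard
    have hinj : ¬ Function.Injective f := fun hinj => by
      have := Nat.card_le_card_of_injective f hinj
      omega
    simp only [Function.Injective, not_forall] at hinj
    obtain ⟨i, j, hf, hij⟩ := hinj
    obtain ⟨G₁, f₁, hsplit, h₁⟩ := h.exists_split hij hf
    obtain ⟨G', hseq, hiso⟩ := ih h₁ (by rw [Finite.card_option]; omega)
    exact ⟨G', ⟨f j, G₁, hsplit, hseq⟩, hiso⟩

lemma isSingleCycle_of_iso_cycleGraph {n : ℕ} {W : Type} {G : SimpleGraph W}
    (e : cycleGraph (n + 3) ≃g G) : IsSingleCycle G := by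
  refine ⟨e.connected_iff.1 cycleGraph_connected, fun v => ?_⟩
  rw [← Nat.card_coe_set_eq, ← e.apply_symm_apply v,
    ← Nat.card_congr (e.mapNeighborSet (e.symm v)), Nat.card_eq_fintype_card,
    card_neighborSet_eq_degree, cycleGraph_degree_three_le]

/-- A closed walk through all vertices and edges of `G` exhibits `G` as a quotient of a cycle. -/
lemma SimpleGraph.Walk.isGraphQuotient_cycleGraph {V : Type} {G : SimpleGraph V} {u : V}
    (p : G.Walk u u) {n : ℕ} (hn : p.length = n + 2) (hvert : ∀ v : V, v ∈ p.support)
    (hedge : ∀ e ∈ G.edgeSet, e ∈ p.edges) :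
    IsGraphQuotient (cycleGraph (n + 2)) G (fun i => p.getVert i) := by
  have succ_eq : ∀ i : Fin (n + 2), p.getVert (i + 1 : Fin (n + 2)) = p.getVert (i + 1 : ℕ) := by
    intro i
    rw [Fin.val_add_one]
    split_ifs with hi
    · simp [hi, p.getVert_of_length_le hn.le]
    · rfl
  have adj_succ : ∀ i : Fin (n + 2),
      G.Adj (p.getVert i) (p.getVert (i + 1 : Fin (n + 2))) := fun i => by
    rw [succ_eq]
    exact p.adj_getVert_succ (by omega)
  refine ⟨fun v => ?_, fun a b => ⟨fun hab => ?_, ?_⟩⟩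
  · obtain ⟨i, rfl, hi⟩ := Walk.mem_support_iff_exists_getVert.1 (hvert v)
    rcases hi.lt_or_eq with hi | rfl
    · exact ⟨⟨i, hn ▸ hi⟩, rfl⟩
    · exact ⟨0, by simp⟩
  · obtain ⟨i, hi, he⟩ := p.mk_mem_edges_iff_exists.1 (hedge s(a, b) hab)
    let i' : Fin (n + 2) := ⟨i, hn ▸ hi⟩
    have hadj : (cycleGraph (n + 2)).Adj i' (i' + 1) := by simp [cycleGraph_adj]
    rcases Sym2.eq_iff.1 he with ⟨ha, hb⟩ | ⟨hb, ha⟩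
    · exact ⟨i', i' + 1, hadj, ha, (succ_eq i').trans hb⟩
    · exact ⟨i' + 1, i', hadj.symm, (succ_eq i').trans ha, hb⟩
  · rintro ⟨i, j, hij, rfl, rfl⟩
    rcases cycleGraph_adj.1 hij with h | h
    · obtain rfl := sub_eq_iff_eq_add'.1 h
      exact (adj_succ j).symm
    · obtain rfl := sub_eq_iff_eq_add'.1 h
      exact adj_succ i

/-- Let `W` be a closed walk in `G` of length `≥ 3` visiting every
vertex and traversing every edge of `G` at least once.  Then there is a sequence of
exactly `|W| - |V(G)|` inclusive vertex splits transforming `G` into a single cycle. -/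
theorem singleCycle_of_closedWalk {V : Type} [Fintype V] (G : SimpleGraph V)
    (w0 : V) (p : G.Walk w0 w0) (hlen : 3 ≤ p.length)
    (hvert : ∀ v : V, v ∈ p.support) (hedge : ∀ e ∈ G.edgeSet, e ∈ p.edges) :
    ∃ G' : SimpleGraph (IterOpt (p.length - Fintype.card V) V),
      InclSeq (p.length - Fintype.card V) V G G' ∧ IsSingleCycle G' := by
  obtain ⟨m, hm⟩ := Nat.exists_eq_add_of_le' hlen
  have hq := p.isGraphQuotient_cycleGraph hm hvert hedge
  have hle := Nat.card_le_card_of_surjective _ hq.surj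
  rw [Nat.card_fin, Nat.card_eq_fintype_card] at hle
  obtain ⟨G', hseq, ⟨e⟩⟩ := hq.exists_inclSeq (p.length - Fintype.card V)
    (by rw [Nat.card_fin, Nat.card_eq_fintype_card]; omega)
  exact ⟨G', hseq, isSingleCycle_of_iso_cycleGraph e⟩
end
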